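/- For every prime d, with q = d², and every δ > 0, there exists n₀ (depending only on q and δ) such that for all n ≥ n₀ and every integer k with n/2 ≤ k ≤ n, there exists an additive code C ⊆ 𝔽_q^n with |C| = q^k and C^⊥ ⊆ C, such that every nonzero vector x ∈ C satisfies H_q(T(x)) ≥ 1 − k/n − δ. -/

import Mathlib

/-!
STATEMENT 1: existence of self-orthogonal-containing additive codes all of whose
nonzero words have types of large entropy (Gilbert–Varshamov bound, entropy form).
-/

open scoped BigOperators

/-- The empirical distribution (type) of a word `x` of length `n` over alphabet `α`. -/
noncomputable def empDist {α : Type*} [DecidableEq α] {n : ℕ} (x : Fin n → α) : α → ℝ :=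
  fun u => ((Finset.univ.filter (fun i => x i = u)).card : ℝ) / n

/-- Base-`q` entropy `H_q(P) = -∑ P(u) log_q P(u)` of a distribution on `α`. -/
noncomputable def entropyBase (q : ℕ) {α : Type*} [Fintype α] (P : α → ℝ) : ℝ :=
  -∑ u, P u * Real.logb q (P u)

/-- The standard symplectic form on `(𝔽_d × 𝔽_d)ⁿ`:
`(x,y) = ∑ᵢ (xᵢ yᵢ' − xᵢ' yᵢ)`. -/
def sympForm {d n : ℕ} (x y : Fin n → ZMod d × ZMod d) : ZMod d :=
  ∑ i, ((x i).1 * (y i).2 - (x i).2 * (y i).1)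

section Counting

open Finset

/-- If `G` acts transitively on `S` and `#A * #B < #S`, some translate of `A` misses `B`. -/
theorem exists_smul_notMem_of_card_mul_lt {G X : Type*} [Group G] [Finite G] [MulAction G X]
    {S A B : Finset X} (hA : A ⊆ S) (hB : B ⊆ S)
    (hstable : ∀ x ∈ S, ∀ g : G, g • x ∈ S)
    (htrans : ∀ x ∈ S, ∀ y ∈ S, ∃ g : G, g • x = y)
    (hcard : #A * #B < #S) : ∃ g : G, ∀ a ∈ A, g • a ∉ B := by
  classical
  have := Fintype.ofFinite G
  obtain ⟨s, hs⟩ : S.Nonempty := card_pos.mp (by omega)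
  set N := #{g : G | g • s = s} with hN
  have hNpos : 0 < N := card_pos.mpr ⟨1, by simp⟩
  have hfib : ∀ x ∈ S, ∀ y ∈ S, #{g : G | g • x = y} = N := by
    intro x hx y hy
    obtain ⟨a, rfl⟩ := htrans s hs x hx
    obtain ⟨b, rfl⟩ := htrans s hs y hy
    refine card_bij' (fun g _ => b⁻¹ * g * a) (fun g _ => b * g * a⁻¹) ?_ ?_ ?_ ?_
    · intro g hg
      simp only [mem_filter, mem_univ, true_and] at hg ⊢
      rw [mul_smul, mul_smul, hg, inv_smul_smul]
    · intro g hg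
      simp only [mem_filter, mem_univ, true_and] at hg ⊢
      rw [mul_smul, mul_smul, inv_smul_smul, hg]
    · intro g _
      group
    · intro g _
      group
  have htotal : Fintype.card G = #S * N := by
    rw [← card_univ, card_eq_sum_card_fiberwise (f := fun g : G => g • s) (t := S)
      (fun g _ => hstable s hs g), sum_congr rfl (hfib s hs), sum_const, smul_eq_mul]
  by_contra! hbad
  have hcover : (univ : Finset G) ⊆ A.biUnion fun a => B.biUnion fun b => {g : G | g • a = b} := by
    intro g _
    obtain ⟨a, ha, hb⟩ := hbad g
    simp only [mem_biUnion, mem_filter, mem_univ, true_and]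
    exact ⟨a, ha, g • a, hb, rfl⟩
  have hle : Fintype.card G ≤ #A * (#B * N) :=
    (card_le_card hcover).trans <| card_biUnion_le_card_mul _ _ _ fun a ha =>
      card_biUnion_le_card_mul _ _ _ fun b hb => (hfib a (hA ha) b (hB hb)).le
  nlinarith

end Counting

section Symplectic

variable {d n : ℕ}

theorem sympForm_add_left (x y z : Fin n → ZMod d × ZMod d) :
    sympForm (x + y) z = sympForm x z + sympForm y z := by
  simp only [sympForm, ← Finset.sum_add_distrib]
  refine Finset.sum_congr rfl fun i _ => ?_
  simp only [Pi.add_apply, Prod.fst_add, Prod.snd_add]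
  ring

theorem sympForm_smul_left (a : ZMod d) (x y : Fin n → ZMod d × ZMod d) :
    sympForm (a • x) y = a * sympForm x y := by
  simp only [sympForm, Finset.mul_sum]
  refine Finset.sum_congr rfl fun i _ => ?_
  simp only [Pi.smul_apply, Prod.smul_fst, Prod.smul_snd, smul_eq_mul]
  ring

theorem sympForm_swap (x y : Fin n → ZMod d × ZMod d) : sympForm y x = -sympForm x y := by
  simp only [sympForm, ← Finset.sum_neg_distrib]
  exact Finset.sum_congr rfl fun i _ => by ring

theorem sympForm_add_right (x y z : Fin n → ZMod d × ZMod d) :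
    sympForm x (y + z) = sympForm x y + sympForm x z := by
  rw [sympForm_swap, sympForm_add_left, sympForm_swap x y, sympForm_swap x z]
  ring

theorem sympForm_smul_right (a : ZMod d) (x y : Fin n → ZMod d × ZMod d) :
    sympForm x (a • y) = a * sympForm x y := by
  rw [sympForm_swap, sympForm_smul_left, sympForm_swap x y]
  ring

theorem sympForm_self (x : Fin n → ZMod d × ZMod d) : sympForm x x = 0 :=
  Finset.sum_eq_zero fun i _ => by ring

theorem sympForm_single_right (x : Fin n → ZMod d × ZMod d) (i : Fin n) (p : ZMod d × ZMod d) :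
    sympForm x (Pi.single i p) = (x i).1 * p.2 - (x i).2 * p.1 := by
  rw [sympForm, Finset.sum_eq_single i]
  · simp
  · intro j _ hj
    simp [Pi.single_eq_of_ne hj]
  · simp

theorem exists_sympForm_ne_zero {x : Fin n → ZMod d × ZMod d} (hx : x ≠ 0) :
    ∃ z, sympForm x z ≠ 0 := by
  contrapose! hx
  ext i
  · simpa [sympForm_single_right] using hx (Pi.single i (0, 1))
  · simpa [sympForm_single_right] using hx (Pi.single i (1, 0))

theorem exists_sympForm_ne_zero_and {x y : Fin n → ZMod d × ZMod d} (hx : x ≠ 0) (hy : y ≠ 0) :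
    ∃ z, sympForm x z ≠ 0 ∧ sympForm y z ≠ 0 := by
  obtain ⟨u, hu⟩ := exists_sympForm_ne_zero hx
  obtain ⟨v, hv⟩ := exists_sympForm_ne_zero hy
  by_cases hyu : sympForm y u = 0
  · by_cases hxv : sympForm x v = 0
    · exact ⟨u + v, by simpa [sympForm_add_right, hxv] using hu,
        by simpa [sympForm_add_right, hyu] using hv⟩
    · exact ⟨v, hxv, hv⟩
  · exact ⟨u, hu, hyu⟩

/-- The symplectic transvection `x ↦ x + a (x, v) v`. -/
def sympTransvection (a : ZMod d) (v : Fin n → ZMod d × ZMod d) :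
    (Fin n → ZMod d × ZMod d) ≃ₗ[ZMod d] (Fin n → ZMod d × ZMod d) where
  toFun x := x + (a * sympForm x v) • v
  invFun x := x + (-a * sympForm x v) • v
  left_inv x := by
    simp only [sympForm_add_left, sympForm_smul_left, sympForm_self]
    module
  right_inv x := by
    simp only [sympForm_add_left, sympForm_smul_left, sympForm_self]
    module
  map_add' x y := by
    simp only [sympForm_add_left]
    module
  map_smul' c x := by
    simp only [sympForm_smul_left, RingHom.id_apply]
    module

theorem sympTransvection_apply (a : ZMod d) (v x : Fin n → ZMod d × ZMod d) :
    sympTransvection a v x = x + (a * sympForm x v) • v := rfl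

variable (d n) in
/-- The linear automorphisms preserving the symplectic form. -/
def sympGroup :
    Subgroup ((Fin n → ZMod d × ZMod d) ≃ₗ[ZMod d] (Fin n → ZMod d × ZMod d)) where
  carrier := {g | ∀ x y, sympForm (g x) (g y) = sympForm x y}
  one_mem' _ _ := rfl
  mul_mem' {_ h} hg hh x y := (hg (h x) (h y)).trans (hh x y)
  inv_mem' {g} hg x y := by
    have h := hg (g.symm x) (g.symm y)
    rw [LinearEquiv.apply_symm_apply, LinearEquiv.apply_symm_apply] at h
    exact h.symm

theorem sympTransvection_mem_sympGroup (a : ZMod d) (v : Fin n → ZMod d × ZMod d) :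
    sympTransvection a v ∈ sympGroup d n := by
  intro x y
  simp only [sympTransvection_apply, sympForm_add_left, sympForm_add_right, sympForm_smul_left,
    sympForm_smul_right, sympForm_self]
  rw [sympForm_swap y v]
  ring

instance [NeZero d] : Finite (sympGroup d n) :=
  Finite.of_injective (fun g => (g.1 : (Fin n → ZMod d × ZMod d) → Fin n → ZMod d × ZMod d))
    (DFunLike.coe_injective.comp Subtype.coe_injective)

variable [Fact d.Prime]

theorem exists_sympGroup_smul_eq_of_sympForm_ne_zero {x y : Fin n → ZMod d × ZMod d}
    (h : sympForm x y ≠ 0) : ∃ g : sympGroup d n, g • x = y := by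
  refine ⟨⟨_, sympTransvection_mem_sympGroup (sympForm x y)⁻¹ (y + (-1 : ZMod d) • x)⟩, ?_⟩
  change sympTransvection _ _ x = y
  rw [sympTransvection_apply, sympForm_add_right, sympForm_smul_right, sympForm_self, mul_zero,
    add_zero, inv_mul_cancel₀ h]
  module

theorem exists_sympGroup_smul_eq {x y : Fin n → ZMod d × ZMod d} (hx : x ≠ 0) (hy : y ≠ 0) :
    ∃ g : sympGroup d n, g • x = y := by
  obtain ⟨z, hxz, hyz⟩ := exists_sympForm_ne_zero_and hx hy
  obtain ⟨g, rfl⟩ := exists_sympGroup_smul_eq_of_sympForm_ne_zero hxz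
  have hzy : sympForm (g • x) y ≠ 0 := by rwa [sympForm_swap, neg_ne_zero]
  obtain ⟨h, rfl⟩ := exists_sympGroup_smul_eq_of_sympForm_ne_zero hzy
  exact ⟨h * g, mul_smul h g x⟩

end Symplectic

section BaseCode

/-- The words whose second components vanish in the first `r` positions. -/
def vanishingCode (d n r : ℕ) : AddSubgroup (Fin n → ZMod d × ZMod d) where
  carrier := {x | ∀ i : Fin n, (i : ℕ) < r → (x i).2 = 0}
  add_mem' hx hy i hi := by simp [hx i hi, hy i hi]
  zero_mem' _ _ := rfl
  neg_mem' hx i hi := by simp [hx i hi]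

theorem mem_vanishingCode_of_forall_sympForm_eq_zero {d n r : ℕ} {y : Fin n → ZMod d × ZMod d}
    (hy : ∀ x ∈ vanishingCode d n r, sympForm x y = 0) : y ∈ vanishingCode d n r := by
  intro i _
  have hmem : (Pi.single i (1, 0) : Fin n → ZMod d × ZMod d) ∈ vanishingCode d n r := by
    intro j _
    by_cases hji : j = i
    · subst hji
      simp
    · simp [Pi.single_eq_of_ne hji]
  have h := hy _ hmem
  rw [sympForm_swap, sympForm_single_right] at h
  simpa using h

theorem card_vanishingCode {d n r : ℕ} [NeZero d] (hr : r ≤ n) :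
    Nat.card (vanishingCode d n r) = d ^ (2 * n - r) := by
  classical
  let t : Fin n → Finset (ZMod d × ZMod d) := fun i =>
    Finset.univ ×ˢ (if (i : ℕ) < r then {0} else Finset.univ)
  have hset : ((vanishingCode d n r : AddSubgroup _) : Set (Fin n → ZMod d × ZMod d)) =
      (Fintype.piFinset t : Set _) := by
    ext x
    simp only [t, Fintype.mem_piFinset, Finset.mem_product, Finset.mem_univ,
      true_and, SetLike.mem_coe]
    refine forall_congr' fun i => ?_
    split_ifs with h <;> simp [h]
  have hcard : ∀ i, (t i).card = d * (if (i : ℕ) < r then 1 else d) := by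
    intro i
    simp only [t, Finset.card_product, Finset.card_univ, ZMod.card]
    split_ifs <;> simp [ZMod.card]
  have hcount : (Finset.univ.filter fun i : Fin n => ¬ (i : ℕ) < r).card = n - r := by
    have h := Finset.card_filter_add_card_filter_not (s := (Finset.univ : Finset (Fin n)))
      (fun i => (i : ℕ) < r)
    rw [Fin.card_filter_val_lt, Finset.card_univ, Fintype.card_fin, min_eq_right hr] at h
    omega
  change Nat.card ((vanishingCode d n r : AddSubgroup _) : Set (Fin n → ZMod d × ZMod d)) = _
  rw [hset, Nat.card_coe_set_eq, Set.ncard_coe_finset, Fintype.card_piFinset,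
    Finset.prod_congr rfl fun i _ => hcard i, Finset.prod_mul_distrib, Finset.prod_ite,
    Finset.prod_const, Finset.prod_const, Finset.prod_const, hcount, one_pow, one_mul,
    Finset.card_univ, Fintype.card_fin, ← pow_add]
  congr 1
  omega

end BaseCode

section Types

open Finset

variable {α : Type*} [DecidableEq α] {n : ℕ}

theorem empDist_nonneg (x : Fin n → α) (u : α) : 0 ≤ empDist x u := by
  unfold empDist
  positivity

theorem empDist_apply_pos (x : Fin n → α) (i : Fin n) : 0 < empDist x (x i) := by
  have hn : 0 < n := i.pos
  have : 0 < #{j | x j = x i} := card_pos.mpr ⟨i, by simp⟩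
  unfold empDist
  positivity

variable [Fintype α]

theorem sum_empDist (hn : n ≠ 0) (x : Fin n → α) : ∑ u, empDist x u = 1 := by
  have h : ∑ u, #{i | x i = u} = n := by
    rw [← card_eq_sum_card_fiberwise (f := x) (t := univ) (by simp), card_univ, Fintype.card_fin]
  simp only [empDist]
  rw [← sum_div, ← Nat.cast_sum, h, div_self (by exact_mod_cast hn)]

/-- A word has probability `q ^ (-n H_q(P))` under the product of its own type `P`. -/
theorem prod_empDist_eq_rpow {q : ℕ} (hq : 1 < q) (hn : n ≠ 0) (x : Fin n → α) :
    ∏ i, empDist x (x i) = (q : ℝ) ^ (-(n * entropyBase q (empDist x))) := by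
  have hq' : (1 : ℝ) < q := by exact_mod_cast hq
  have hn' : (n : ℝ) ≠ 0 := by exact_mod_cast hn
  rw [← Real.rpow_logb (by linarith) hq'.ne' (prod_pos fun i _ => empDist_apply_pos x i),
    Real.logb_prod _ _ fun i _ => (empDist_apply_pos x i).ne']
  congr 1
  rw [← sum_fiberwise_of_maps_to (g := x) (t := univ) (by simp), entropyBase, mul_neg, neg_neg,
    mul_sum]
  refine sum_congr rfl fun u _ => ?_
  rw [sum_congr rfl (g := fun _ => Real.logb q (empDist x u)) (by
    intro i hi
    rw [(mem_filter.mp hi).2]), sum_const, nsmul_eq_mul, ← mul_assoc]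
  congr 1
  rw [empDist, mul_div_cancel₀ _ hn']

theorem sum_prod_empDist_le (hn : n ≠ 0) :
    ∑ x : Fin n → α, ∏ i, empDist x (x i) ≤ ((n : ℝ) + 1) ^ Fintype.card α := by
  let c : (Fin n → α) → α → Fin (n + 1) := fun x u =>
    ⟨#{i | x i = u}, Nat.lt_succ_of_le ((card_le_univ _).trans_eq (Fintype.card_fin n))⟩
  have hc : ∀ x y, c x = c y → empDist x = empDist y := by
    intro x y h
    funext u
    have hu : #{i | x i = u} = #{i | y i = u} := congrArg Fin.val (congrFun h u)
    rw [empDist, empDist, hu]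
  rw [← sum_fiberwise_of_maps_to (g := c) (t := univ) (by simp)]
  have hfib : ∀ p : α → Fin (n + 1), ∑ x with c x = p, ∏ i, empDist x (x i) ≤ 1 := by
    intro p
    obtain hp | ⟨y, hy⟩ := (univ.filter fun x => c x = p).eq_empty_or_nonempty
    · rw [hp, sum_empty]
      exact zero_le_one
    · have hy' : c y = p := (mem_filter.mp hy).2
      calc ∑ x with c x = p, ∏ i, empDist x (x i)
          = ∑ x with c x = p, ∏ i, empDist y (x i) :=
            sum_congr rfl fun x hx => by
              rw [hc x y ((mem_filter.mp hx).2.trans hy'.symm)]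
        _ ≤ ∑ x : Fin n → α, ∏ i, empDist y (x i) :=
            sum_le_sum_of_subset_of_nonneg (filter_subset _ _) fun x _ _ =>
              prod_nonneg fun i _ => empDist_nonneg y (x i)
        _ = 1 := by
            rw [← Fintype.piFinset_univ, ← prod_univ_sum (fun _ => univ) fun _ u => empDist y u,
              prod_congr rfl fun _ _ => sum_empDist hn y, prod_const_one]
  refine (sum_le_sum fun p _ => hfib p).trans_eq ?_
  simp

/-- There are at most `(n + 1) ^ |α| q ^ (n h)` words whose type has entropy below `h`. -/
theorem card_entropyBase_lt_le {q : ℕ} (hq : 1 < q) (hn : n ≠ 0) (h : ℝ) :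
    (#{x : Fin n → α | entropyBase q (empDist x) < h} : ℝ) ≤
      ((n : ℝ) + 1) ^ Fintype.card α * (q : ℝ) ^ (n * h) := by
  have hq' : (1 : ℝ) < q := by exact_mod_cast hq
  have hpos : (0 : ℝ) < (q : ℝ) ^ (n * h) := Real.rpow_pos_of_pos (by linarith) _
  rw [← div_le_iff₀ hpos, div_eq_mul_inv, ← Real.rpow_neg (by linarith), ← nsmul_eq_mul]
  refine (card_nsmul_le_sum _ (fun x => ∏ i, empDist x (x i)) _ fun x hx => ?_).trans
    ((sum_le_sum_of_subset_of_nonneg (filter_subset _ _) fun x _ _ =>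
      prod_nonneg fun i _ => empDist_nonneg x (x i)).trans (sum_prod_empDist_le hn))
  rw [prod_empDist_eq_rpow hq hn]
  refine Real.rpow_le_rpow_of_exponent_le hq'.le (neg_le_neg ?_)
  exact mul_le_mul_of_nonneg_left (mem_filter.mp hx).2.le (Nat.cast_nonneg n)

end Types

theorem eventually_add_one_pow_lt_rpow (m : ℕ) {b δ : ℝ} (hb : 1 < b) (hδ : 0 < δ) :
    ∃ n₀ : ℕ, ∀ n : ℕ, n₀ ≤ n → ((n : ℝ) + 1) ^ m < b ^ (n * δ) := by
  have hb0 : 0 < b := by linarith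
  have hr0 : 0 < b ^ (-δ) := Real.rpow_pos_of_pos hb0 _
  have hr1 : |b ^ (-δ)| < 1 := by
    rw [abs_of_pos hr0]
    exact Real.rpow_lt_one_of_one_lt_of_neg hb (by linarith)
  have hlim := (Filter.tendsto_add_atTop_iff_nat 1).mpr
    (tendsto_pow_const_mul_const_pow_of_abs_lt_one m hr1)
  obtain ⟨n₀, h⟩ := Filter.eventually_atTop.mp (hlim.eventually_lt_const hr0)
  refine ⟨n₀, fun n hn => ?_⟩
  have h' := h n hn
  rw [pow_succ, ← mul_assoc, mul_lt_iff_lt_one_left hr0, ← Real.rpow_mul_natCast hb0.le] at h'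
  push_cast at h'
  rw [show -δ * (n : ℝ) = -(n * δ) by ring, Real.rpow_neg hb0.le, ← div_eq_mul_inv,
    div_lt_one (Real.rpow_pos_of_pos hb0 _)] at h'
  exact h'

theorem gv_bound_additive_codes_entropy (d : ℕ) [Fact d.Prime] (q : ℕ) (hq : q = d ^ 2)
    (δ : ℝ) (hδ : 0 < δ) :
    ∃ n₀ : ℕ, ∀ n : ℕ, n₀ ≤ n → ∀ k : ℕ, n ≤ 2 * k → k ≤ n →
      ∃ C : AddSubgroup (Fin n → ZMod d × ZMod d),
        Nat.card C = q ^ k ∧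
        (∀ y : Fin n → ZMod d × ZMod d, (∀ x ∈ C, sympForm x y = 0) → y ∈ C) ∧
        (∀ x : Fin n → ZMod d × ZMod d, x ∈ C → x ≠ 0 →
          entropyBase q (empDist x) ≥ 1 - (k : ℝ) / n - δ) := by
  classical
  have hd : 1 < d := (Fact.out : d.Prime).one_lt
  have hq1 : 1 < q := hq ▸ Nat.one_lt_pow two_ne_zero hd
  have hq1' : (1 : ℝ) < q := by exact_mod_cast hq1
  obtain ⟨n₀, hn₀⟩ := eventually_add_one_pow_lt_rpow q hq1' hδ
  refine ⟨n₀ + 1, fun n hn k hk hkn => ?_⟩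
  have hn0 : n ≠ 0 := by omega
  have hαcard : Fintype.card (ZMod d × ZMod d) = q := by
    rw [Fintype.card_prod, ZMod.card, hq, sq]
  have hVcard : Fintype.card (Fin n → ZMod d × ZMod d) = q ^ n := by
    rw [Fintype.card_fun, hαcard, Fintype.card_fin]
  set C₀ := vanishingCode d n (2 * (n - k)) with hC₀
  have hC₀card : Nat.card C₀ = q ^ k := by
    rw [hC₀, card_vanishingCode (by omega), hq, ← pow_mul]
    congr 1
    omega
  set bad : Finset (Fin n → ZMod d × ZMod d) :=
    {x | entropyBase q (empDist x) < 1 - (k : ℝ) / n - δ} with hbad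
  have hbadcard : bad.card * q ^ k < q ^ n := by
    have hle : (bad.card : ℝ) ≤ _ :=
      card_entropyBase_lt_le (α := ZMod d × ZMod d) hq1 hn0 (1 - (k : ℝ) / n - δ)
    have hqpos : (0 : ℝ) < q := by linarith
    have hexp : (q : ℝ) ^ (n * (1 - (k : ℝ) / n - δ)) * (q : ℝ) ^ k * (q : ℝ) ^ (n * δ) =
        (q : ℝ) ^ n := by
      rw [← Real.rpow_natCast, ← Real.rpow_natCast, ← Real.rpow_add hqpos, ← Real.rpow_add hqpos]
      congr 1
      field_simp
      ring
    rw [hαcard] at hle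
    have hlt : (bad.card : ℝ) * (q : ℝ) ^ k < (q : ℝ) ^ n := by
      rw [← hexp]
      calc (bad.card : ℝ) * (q : ℝ) ^ k
          ≤ ((n : ℝ) + 1) ^ q * (q : ℝ) ^ (n * (1 - (k : ℝ) / n - δ)) * (q : ℝ) ^ k := by gcongr
        _ = (q : ℝ) ^ (n * (1 - (k : ℝ) / n - δ)) * (q : ℝ) ^ k * ((n : ℝ) + 1) ^ q := by ring
        _ < _ := by
          gcongr
          exact hn₀ n (by omega)
    exact_mod_cast hlt
  set A : Finset (Fin n → ZMod d × ZMod d) := {x | x ∈ C₀ ∧ x ≠ 0} with hA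
  have hAcard : A.card + 1 = q ^ k := by
    have herase : A = (Finset.univ.filter (· ∈ C₀)).erase 0 := by
      ext x
      simp [hA, and_comm]
    rw [herase, Finset.card_erase_add_one (by simp [C₀.zero_mem]), ← hC₀card,
      Nat.card_eq_fintype_card, Fintype.card_subtype]
  have hScard : (Finset.univ.erase (0 : Fin n → ZMod d × ZMod d)).card + 1 = q ^ n := by
    rw [Finset.card_erase_add_one (Finset.mem_univ _), Finset.card_univ, hVcard]
  have hone : 1 < q ^ n := Nat.one_lt_pow hn0 hq1
  obtain ⟨g, hg⟩ := exists_smul_notMem_of_card_mul_lt (G := sympGroup d n)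
    (S := Finset.univ.erase 0) (A := A) (B := bad.erase 0)
    (fun x hx => by simpa using (Finset.mem_filter.mp hx).2.2)
    (Finset.erase_subset_erase _ (Finset.subset_univ _))
    (fun x hx g => Finset.mem_erase.mpr
      ⟨(smul_ne_zero_iff_ne g).mpr (Finset.ne_of_mem_erase hx), Finset.mem_univ _⟩)
    (fun x hx y hy => exists_sympGroup_smul_eq (Finset.ne_of_mem_erase hx)
      (Finset.ne_of_mem_erase hy))
    (by
      have hle : (bad.erase 0).card ≤ bad.card := Finset.card_erase_le
      rcases Nat.eq_zero_or_pos (bad.erase 0).card with h0 | h0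
      · rw [h0]
        omega
      · have : A.card * (bad.erase 0).card ≤ A.card * bad.card := Nat.mul_le_mul_left _ hle
        rw [← hAcard] at hbadcard
        nlinarith)
  refine ⟨C₀.map (g.1.toAddEquiv : _ →+ _), ?_, ?_, ?_⟩
  · rw [← hC₀card]
    exact AddSubgroup.card_map_of_injective g.1.injective
  · intro y hy
    refine ⟨g⁻¹ • y, mem_vanishingCode_of_forall_sympForm_eq_zero fun x hx => ?_,
      smul_inv_smul g y⟩
    have h := hy _ ⟨x, hx, rfl⟩
    rw [← g⁻¹.2] at h
    rwa [← inv_smul_smul g x]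
  · rintro _ ⟨x, hx, rfl⟩ hx0
    by_contra! hlt
    have hx0' : x ≠ 0 := by
      rintro rfl
      exact hx0 (map_zero _)
    exact hg x (Finset.mem_filter.mpr ⟨Finset.mem_univ _, hx, hx0'⟩)
      (Finset.mem_erase.mpr ⟨hx0, Finset.mem_filter.mpr ⟨Finset.mem_univ _, hlt⟩⟩)
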